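/- arXiv:1511.07605 — 4 statements merged into one kernel-verified Lean document; each statement's English description precedes it below -/
import Mathlib

section
/- Approximate Poincaré–Bendixson theorem (qualitative form): Let d ≥ 2, let 0 < ε < 1, let L > 0, and let f : ℝᵈ → ℝᵈ be L-Lipschitz continuous. Suppose x : [0,∞) → ℝᵈ is differentiable with x'(t) = f(x(t)) and x(t) ∈ [0,1]ᵈ for all t ≥ 0, and suppose f has no ε-fixpoint in [0,1]ᵈ, i.e. ‖f(y)‖ ≥ ε for all y ∈ [0,1]ᵈ. Then the trajectory contains an (ε/L)-cycle: there exist times 0 ≤ t₁ < t₂ such that ‖x(t₂) − x(t₁)‖ ≤ ε/L, ⟨x(t₂) − x(t₁), f(x(t₁))⟩ = 0, and ⟨f(x(t₁)), f(x(t₂))⟩ > 0. -/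
open RealInnerProductSpace

lemma isCompact_euclidean_unit_cube (d : ℕ) :
    IsCompact {y : EuclideanSpace ℝ (Fin d) | ∀ i, y i ∈ Set.Icc (0 : ℝ) 1} := by
  have h := (isCompact_univ_pi (fun _ : Fin d => isCompact_Icc (a := (0 : ℝ)) (b := 1))).image
    (PiLp.continuous_toLp 2 (fun _ : Fin d => ℝ))
  convert h using 1
  ext y
  constructor
  · intro hy
    exact ⟨y.ofLp, fun i _ => hy i, rfl⟩
  · rintro ⟨z, hz, rfl⟩ i
    exact hz i trivial

/-- A sequence in a compact set has two distinct terms that are arbitrarily close. -/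
lemma IsCompact.exists_lt_dist_lt {X : Type*} [PseudoMetricSpace X] {K : Set X} (hK : IsCompact K)
    {u : ℕ → X} (hu : ∀ n, u n ∈ K) {δ : ℝ} (hδ : 0 < δ) : ∃ m n, m < n ∧ dist (u n) (u m) < δ := by
  obtain ⟨a, -, φ, hφ, hlim⟩ := hK.tendsto_subseq hu
  obtain ⟨N, hN⟩ := Metric.cauchySeq_iff.1 hlim.cauchySeq δ hδ
  exact ⟨φ N, φ (N + 1), hφ N.lt_succ_self, hN (N + 1) (by omega) N le_rfl⟩

/-- If `w` differs from `v` by at most half the norm of `v`, then `⟪v, w⟫` is at least half the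
squared norm of `v`. -/
lemma half_norm_sq_le_inner {E : Type*} [NormedAddCommGroup E] [InnerProductSpace ℝ E] {v w : E}
    (h : ‖w - v‖ ≤ ‖v‖ / 2) : ‖v‖ ^ 2 / 2 ≤ ⟪v, w⟫ := by
  have h1 : ⟪v, w⟫ = ‖v‖ ^ 2 + ⟪v, w - v⟫ := by
    rw [inner_sub_right, real_inner_self_eq_norm_sq]; ring
  have h2 := neg_le_of_abs_le (abs_real_inner_le_norm v (w - v))
  nlinarith [mul_le_mul_of_nonneg_left h (norm_nonneg v)]

/-- Approximate Poincaré–Bendixson theorem (qualitative form). -/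
theorem approx_poincare_bendixson_qualitative
    (d : ℕ) (hd : 2 ≤ d) (ε L : ℝ) (hε0 : 0 < ε) (hε1 : ε < 1) (hL : 0 < L)
    (f : EuclideanSpace ℝ (Fin d) → EuclideanSpace ℝ (Fin d))
    (hf : ∀ a b, ‖f a - f b‖ ≤ L * ‖a - b‖)
    (x : ℝ → EuclideanSpace ℝ (Fin d))
    (hx : ∀ t, 0 ≤ t → HasDerivAt x (f (x t)) t)
    (hcube : ∀ t, 0 ≤ t → ∀ i, x t i ∈ Set.Icc (0 : ℝ) 1)
    (hnofix : ∀ y : EuclideanSpace ℝ (Fin d), (∀ i, y i ∈ Set.Icc (0 : ℝ) 1) → ε ≤ ‖f y‖) :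
    ∃ t₁ t₂ : ℝ, 0 ≤ t₁ ∧ t₁ < t₂ ∧
      ‖x t₂ - x t₁‖ ≤ ε / L ∧
      ⟪x t₂ - x t₁, f (x t₁)⟫ = 0 ∧
      0 < ⟪f (x t₁), f (x t₂)⟫ := by
  have hfc : Continuous f := (LipschitzWith.of_dist_le_mul (K := ⟨L, hL.le⟩) fun a b => by
    rw [dist_eq_norm, dist_eq_norm]
    exact hf a b).continuous
  obtain ⟨M, hM⟩ := (isCompact_euclidean_unit_cube d).exists_bound_of_continuousOn hfc.continuousOn
  have hM0 : 0 < M := hε0.trans_le ((hnofix _ (hcube 0 le_rfl)).trans (hM _ (hcube 0 le_rfl)))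
  have hlip : ∀ s, 0 ≤ s → ∀ t, 0 ≤ t → ‖x t - x s‖ ≤ M * ‖t - s‖ := fun s hs t ht =>
    (convex_Ici (0 : ℝ)).norm_image_sub_le_of_norm_hasDerivWithin_le
      (fun u hu => (hx u hu).hasDerivWithinAt) (fun u hu => hM _ (hcube u hu)) hs ht
  have hr : 0 < ε / L := div_pos hε0 hL
  obtain ⟨τ, hτ0, hτ⟩ : ∃ τ, 0 < τ ∧ M * τ = ε / L / 4 :=
    ⟨ε / L / 4 / M, by positivity, by field_simp⟩
  obtain ⟨δ, hδ0, hδr, hδτ⟩ : ∃ δ, 0 < δ ∧ δ ≤ ε / L / 4 ∧ δ ≤ τ * ε / 2 :=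
    ⟨min (ε / L / 4) (τ * ε / 2), by positivity, min_le_left _ _, min_le_right _ _⟩
  obtain ⟨m, n, hmn, hdist⟩ := (isCompact_euclidean_unit_cube d).exists_lt_dist_lt
    (u := fun n : ℕ => x (2 * τ * n)) (fun n => hcube _ (by positivity)) hδ0
  rw [dist_eq_norm] at hdist
  have ht₁ : 0 ≤ 2 * τ * m := by positivity
  have hgap : 2 * τ * m + 2 * τ ≤ 2 * τ * n := by
    have : (m : ℝ) + 1 ≤ n := by exact_mod_cast hmn
    nlinarith
  generalize 2 * τ * (m : ℝ) = t₁ at *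
  generalize 2 * τ * (n : ℝ) = s at *
  have hv : ε ≤ ‖f (x t₁)‖ := hnofix _ (hcube _ ht₁)
  have hnear : ∀ t ∈ Set.Icc (s - τ) (s + τ), ‖x t - x t₁‖ ≤ ε / L / 2 := fun t ht => by
    have h1 := hlip s (by linarith) t (by linarith [ht.1])
    have h2 : ‖t - s‖ ≤ τ := by
      rw [Real.norm_eq_abs, abs_le]; constructor <;> linarith [ht.1, ht.2]
    have h3 := norm_sub_le_norm_sub_add_norm_sub (x t) (x s) (x t₁)
    nlinarith
  have hinner : ∀ t ∈ Set.Icc (s - τ) (s + τ), ‖f (x t₁)‖ ^ 2 / 2 ≤ ⟪f (x t₁), f (x t)⟫ :=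
    fun t ht => half_norm_sq_le_inner <| by
      calc ‖f (x t) - f (x t₁)‖ ≤ L * ‖x t - x t₁‖ := hf _ _
        _ ≤ L * (ε / L / 2) := by gcongr; exact hnear t ht
        _ = ε / 2 := by field_simp
        _ ≤ ‖f (x t₁)‖ / 2 := by gcongr
  have hg : ∀ t ∈ Set.Icc (s - τ) (s + τ),
      HasDerivAt (fun t => ⟪f (x t₁), x t - x t₁⟫) ⟪f (x t₁), f (x t)⟫ t := fun t ht => by
    simpa using (hasDerivAt_const t (f (x t₁))).inner ℝ
      ((hx t (by linarith [ht.1])).sub_const (x t₁))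
  have hgc : ContinuousOn (fun t => ⟪f (x t₁), x t - x t₁⟫) (Set.Icc (s - τ) (s + τ)) :=
    fun t ht => (hg t ht).continuousAt.continuousWithinAt
  have hgrow := (convex_Icc (s - τ) (s + τ)).mul_sub_le_image_sub_of_le_deriv hgc
    (fun t ht => (hg t (interior_subset ht)).differentiableAt.differentiableWithinAt)
    (C := ‖f (x t₁)‖ ^ 2 / 2)
    (fun t ht => (hg t (interior_subset ht)).deriv ▸ hinner t (interior_subset ht))
  have hmid := abs_le.1 (abs_real_inner_le_norm (f (x t₁)) (x s - x t₁))
  have hsmall : ‖f (x t₁)‖ * ‖x s - x t₁‖ ≤ ‖f (x t₁)‖ ^ 2 / 2 * τ := by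
    have : ‖x s - x t₁‖ ≤ ‖f (x t₁)‖ * τ / 2 := by nlinarith
    nlinarith [mul_le_mul_of_nonneg_left this (norm_nonneg (f (x t₁)))]
  have hs : s ∈ Set.Icc (s - τ) (s + τ) := ⟨by linarith, by linarith⟩
  have hle : s - τ ≤ s + τ := by linarith
  have hlo := hgrow _ (Set.left_mem_Icc.2 hle) _ hs (by linarith)
  have hhi := hgrow _ hs _ (Set.right_mem_Icc.2 hle) (by linarith)
  obtain ⟨t₂, ht₂, hzero⟩ := intermediate_value_Icc hle hgc
    (show (0 : ℝ) ∈ Set.Icc _ _ from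
      ⟨by simp only [sub_sub_cancel] at hlo; linarith,
        by simp only [add_sub_cancel_left] at hhi; linarith⟩)
  refine ⟨t₁, t₂, ht₁, by linarith [ht₂.1], by linarith [hnear t₂ ht₂], ?_, ?_⟩
  · rw [real_inner_comm]
    exact hzero
  · have hpos : 0 < ‖f (x t₁)‖ := hε0.trans_le hv
    exact (by positivity : 0 < ‖f (x t₁)‖ ^ 2 / 2).trans_le (hinner t₂ ht₂)
end

section
/- Approximate Poincaré–Bendixson theorem (quantitative form): For every dimension d ≥ 2 there exists a constant C > 0, depending only on d, with the following property. Let 0 < ε < 1, let L ≥ ε, and let f : ℝᵈ → ℝᵈ be L-Lipschitz continuous. Suppose x : [0,∞) → ℝᵈ is differentiable with x'(t) = f(x(t)) and x(t) ∈ [0,1]ᵈ for all t ≥ 0, and suppose ‖f(y)‖ ≥ ε for all y ∈ [0,1]ᵈ. Then there exist times 0 ≤ t₁ < t₂ with t₂ ≤ C·(1 + L/ε)ᵈ/ε such that ‖x(t₂) − x(t₁)‖ ≤ ε/L, ⟨x(t₂) − x(t₁), f(x(t₁))⟩ = 0, and ⟨f(x(t₁)), f(x(t₂))⟩ > 0;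 in particular an (ε/L)-cycle is found within time O((L/ε)ᵈ) along any orbit. -/
open RealInnerProductSpace

/-- A curve `y` starting near the origin, on the nonpositive side of the hyperplane `v⊥`, whose
velocity is within `L * ‖y‖` of `v`, crosses that hyperplane before leaving a small ball. -/
theorem exists_inner_eq_zero_of_norm_deriv_sub_le {E : Type*} [NormedAddCommGroup E]
    [InnerProductSpace ℝ E] {y y' : ℝ → E} {v : E} {L ρ : ℝ} (hv : v ≠ 0) (hL : 0 < L)
    (hρ : 0 < ρ) (hLρ : L * ρ ≤ ‖v‖ / 2)
    (hy : ∀ u ∈ Set.Icc 0 (ρ / (4 * ‖v‖)), HasDerivAt y (y' u) u)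
    (hy' : ∀ u ∈ Set.Icc 0 (ρ / (4 * ‖v‖)), ‖y' u - v‖ ≤ L * ‖y u‖)
    (h0 : ‖y 0‖ ≤ ρ / 8) (h0v : ⟪y 0, v⟫ ≤ 0) :
    ∃ u ∈ Set.Icc 0 (ρ / (4 * ‖v‖)), ‖y u‖ ≤ ρ ∧ ⟪y u, v⟫ = 0 := by
  have hv0 : 0 < ‖v‖ := norm_pos_iff.2 hv
  set τ := ρ / (4 * ‖v‖) with hτ
  have hτ0 : 0 < τ := by positivity
  have hτv : τ * ‖v‖ = ρ / 4 := by rw [hτ]; field_simp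
  have hcont : ContinuousOn y (Set.Icc 0 τ) := fun u hu =>
    (hy u hu).continuousAt.continuousWithinAt
  have hnear : ∀ u ∈ Set.Icc 0 τ, ρ / 8 + 2 * ‖v‖ * u ≤ ρ := by
    intro u hu
    nlinarith [mul_le_mul_of_nonneg_right hu.2 hv0.le]
  have hbound : ∀ u ∈ Set.Icc 0 τ, ‖y u‖ ≤ ρ / 8 + 2 * ‖v‖ * u := by
    intro u hu
    refine image_norm_le_of_norm_deriv_right_lt_deriv_boundary (f := y) (f' := y')
      (B := fun u => ρ / 8 + 2 * ‖v‖ * u) (B' := fun _ => 2 * ‖v‖) hcont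
      (fun w hw => (hy w ⟨hw.1, hw.2.le⟩).hasDerivWithinAt) (by simpa using h0)
      (fun w => by
        simpa using ((hasDerivAt_id w).const_mul (2 * ‖v‖)).const_add (ρ / 8)) ?_ hu
    intro w hw hyw
    have hw' : w ∈ Set.Icc 0 τ := ⟨hw.1, hw.2.le⟩
    have h1 : ‖y w‖ ≤ ρ := hyw.trans_le (hnear w hw')
    have h2 := norm_le_norm_add_norm_sub v (y' w)
    rw [norm_sub_rev] at h2
    have h3 := hy' w hw'
    have h4 := mul_le_mul_of_nonneg_left h1 hL.le
    linarith
  have hball : ∀ u ∈ Set.Icc 0 τ, ‖y u‖ ≤ ρ := fun u hu => (hbound u hu).trans (hnear u hu)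
  have hderiv : ∀ u ∈ Set.Icc 0 τ, HasDerivAt (fun u => ⟪y u, v⟫) ⟪y' u, v⟫ u := by
    intro u hu
    simpa using (hy u hu).inner ℝ (hasDerivAt_const u v)
  have hslope : ∀ u ∈ Set.Icc 0 τ, ‖v‖ ^ 2 / 2 ≤ ⟪y' u, v⟫ := by
    intro u hu
    have h1 : ⟪y' u, v⟫ = ‖v‖ ^ 2 + ⟪y' u - v, v⟫ := by
      rw [inner_sub_left, real_inner_self_eq_norm_sq]; ring
    have h2 := neg_le_of_abs_le (abs_real_inner_le_norm (y' u - v) v)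
    have h3 : ‖y' u - v‖ ≤ ‖v‖ / 2 :=
      (hy' u hu).trans ((mul_le_mul_of_nonneg_left (hball u hu) hL.le).trans hLρ)
    have h4 := mul_le_mul_of_nonneg_right h3 hv0.le
    nlinarith
  have hicont : ContinuousOn (fun u => ⟪y u, v⟫) (Set.Icc 0 τ) := fun u hu =>
    (hderiv u hu).continuousAt.continuousWithinAt
  have hend : 0 ≤ ⟪y τ, v⟫ := by
    obtain ⟨c, hc, hce⟩ := exists_hasDerivAt_eq_slope (fun u => ⟪y u, v⟫) (fun u => ⟪y' u, v⟫)
      hτ0 hicont fun u hu => hderiv u ⟨hu.1.le, hu.2.le⟩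
    have h1 := hslope c ⟨hc.1.le, hc.2.le⟩
    rw [hce, sub_zero, le_div_iff₀ hτ0] at h1
    have h2 := neg_le_of_abs_le (abs_real_inner_le_norm (y 0) v)
    have h3 := mul_le_mul_of_nonneg_right h0 hv0.le
    have h4 : ‖v‖ ^ 2 / 2 * τ = ρ / 8 * ‖v‖ := by linear_combination (‖v‖ / 2) * hτv
    linarith
  obtain ⟨u, hu, hu0⟩ := intermediate_value_Icc hτ0.le hicont ⟨h0v, hend⟩
  exact ⟨u, hu, hball u hu, hu0⟩

/-- Among more than `(N + 1) ^ d` points of the unit cube, two are at distance at most `d / N`. -/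
theorem exists_lt_norm_sub_le_of_mem_cube {d N : ℕ} (hN : 0 < N)
    (p : ℕ → EuclideanSpace ℝ (Fin d)) (hp : ∀ k i, p k i ∈ Set.Icc (0 : ℝ) 1) :
    ∃ j k : ℕ, j < k ∧ k ≤ (N + 1) ^ d ∧ ‖p k - p j‖ ≤ d / N := by
  have hN0 : (0 : ℝ) < N := by exact_mod_cast hN
  have hfloor : ∀ k i, ⌊N * p k i⌋₊ < N + 1 := fun k i => by
    refine Nat.lt_succ_of_le (Nat.floor_le_of_le ?_)
    exact mul_le_of_le_one_right hN0.le (hp k i).2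
  let cell : Fin ((N + 1) ^ d + 1) → Fin d → Fin (N + 1) := fun k i => ⟨⌊N * p k i⌋₊, hfloor k i⟩
  have hclose : ∀ a b, cell a = cell b → ‖p b - p a‖ ≤ d / N := by
    intro a b hab
    have hcoord : ∀ i, |p b i - p a i| ≤ 1 / N := by
      intro i
      have h : ⌊N * p a i⌋₊ = ⌊N * p b i⌋₊ := congrArg Fin.val (congrFun hab i)
      have h1 := Nat.floor_le (mul_nonneg hN0.le (hp a i).1)
      have h2 := Nat.lt_floor_add_one (N * p a i)
      have h3 := Nat.floor_le (mul_nonneg hN0.le (hp b i).1)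
      have h4 := Nat.lt_floor_add_one (N * p b i)
      rw [h] at h1 h2
      rw [le_div_iff₀ hN0, ← abs_of_pos hN0, ← abs_mul, abs_le]
      constructor <;> nlinarith
    refine le_of_sq_le_sq ?_ (by positivity)
    rw [EuclideanSpace.real_norm_sq_eq]
    calc ∑ i, (p b - p a) i ^ 2 ≤ ∑ _i : Fin d, (1 / N : ℝ) ^ 2 :=
          Finset.sum_le_sum fun i _ => sq_le_sq' (neg_le_of_abs_le (hcoord i))
            (le_of_abs_le (hcoord i))
      _ = d * (1 / N : ℝ) ^ 2 := by simp
      _ ≤ (d : ℝ) ^ 2 * (1 / N : ℝ) ^ 2 := by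
          gcongr
          exact_mod_cast Nat.le_self_pow two_ne_zero d
      _ = (d / N : ℝ) ^ 2 := by ring
  obtain ⟨a, b, hne, hab⟩ := Fintype.exists_ne_map_eq_of_card_lt cell (by simp)
  rcases lt_or_gt_of_ne hne with h | h
  · exact ⟨a, b, h, Nat.lt_succ_iff.1 b.2, hclose a b hab⟩
  · exact ⟨b, a, h, Nat.lt_succ_iff.1 a.2, hclose b a hab.symm⟩

/-- A solution returning close to an earlier position `x t` also returns, at a nearby time, to the
small disc centred at `x t` orthogonal to the velocity there. -/
theorem exists_return_of_norm_sub_le {E : Type*} [NormedAddCommGroup E] [InnerProductSpace ℝ E]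
    {f : E → E} {x : ℝ → E} {ε L t s : ℝ} (hε : 0 < ε) (hL : 0 < L)
    (hf : ∀ a b, ‖f a - f b‖ ≤ L * ‖a - b‖) (hx : ∀ t, 0 ≤ t → HasDerivAt x (f (x t)) t)
    (ht : 0 ≤ t) (hts : t + 1 / L ≤ s) (hft : ε ≤ ‖f (x t)‖)
    (hclose : ‖x s - x t‖ ≤ ε / (16 * L)) :
    ∃ s', t < s' ∧ s' ≤ s + 1 / L ∧ ‖x s' - x t‖ ≤ ε / L ∧ ⟪x s' - x t, f (x t)⟫ = 0 ∧
      0 < ⟪f (x t), f (x s')⟫ := by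
  set v := f (x t) with hvdef
  have hv0 : 0 < ‖v‖ := hε.trans_le hft
  have hv : v ≠ 0 := norm_pos_iff.1 hv0
  set ρ := ε / (2 * L) with hρdef
  have hρ : 0 < ρ := by positivity
  have hLρ' : L * ρ = ε / 2 := by rw [hρdef]; field_simp
  have hLρ : L * ρ ≤ ‖v‖ / 2 := by linarith
  have hτ : ρ / (4 * ‖v‖) < 1 / L := by
    rw [div_lt_div_iff₀ (by positivity) hL]; linarith
  have hclose' : ‖x s - x t‖ ≤ ρ / 8 := hclose.trans_eq (by rw [hρdef]; field_simp; norm_num)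
  suffices h : ∃ s', s - ρ / (4 * ‖v‖) ≤ s' ∧ s' ≤ s + ρ / (4 * ‖v‖) ∧ ‖x s' - x t‖ ≤ ρ ∧
      ⟪x s' - x t, v⟫ = 0 by
    obtain ⟨s', h1, h2, h3, h4⟩ := h
    refine ⟨s', by linarith, by linarith, h3.trans ?_, h4, ?_⟩
    · rw [hρdef]; gcongr; linarith
    · have h5 : ⟪v, f (x s')⟫ = ‖v‖ ^ 2 + ⟪v, f (x s') - v⟫ := by
        rw [inner_sub_right, real_inner_self_eq_norm_sq]; ring
      have h6 := neg_le_of_abs_le (abs_real_inner_le_norm v (f (x s') - v))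
      have h7 : ‖f (x s') - v‖ ≤ ‖v‖ / 2 :=
        (hf _ _).trans ((mul_le_mul_of_nonneg_left h3 hL.le).trans hLρ)
      have h8 := mul_le_mul_of_nonneg_left h7 hv0.le
      nlinarith
  rcases le_total ⟪x s - x t, v⟫ 0 with hside | hside
  · obtain ⟨u, hu, h1, h2⟩ := exists_inner_eq_zero_of_norm_deriv_sub_le
      (y := fun u => x (s + u) - x t) (y' := fun u => f (x (s + u))) hv hL hρ hLρ
      (fun u hu => ((hx (s + u) (by have := hu.1; have := one_div_pos.2 hL; linarith)).comp_const_add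
        s u).sub_const _) (fun u _ => hf _ _) (by simpa using hclose') (by simpa using hside)
    exact ⟨s + u, by linarith [hu.1, hu.2], by linarith [hu.2], h1, h2⟩
  · rw [← norm_neg v] at hLρ
    obtain ⟨u, hu, h1, h2⟩ := exists_inner_eq_zero_of_norm_deriv_sub_le
      (y := fun u => x (s - u) - x t) (y' := fun u => -f (x (s - u))) (neg_ne_zero.2 hv) hL hρ hLρ
      (fun u hu => ((hx (s - u) (by
        have := hu.2; rw [norm_neg] at this; linarith)).comp_const_sub s u).sub_const _)
      (fun u _ => by
        rw [← neg_sub', norm_neg]; exact hf _ _)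
      (by simpa using hclose') (by simpa [inner_neg_right] using hside)
    rw [norm_neg] at hu
    exact ⟨s - u, by linarith [hu.2], by linarith [hu.1, hu.2], h1, by
      simpa [inner_neg_right] using h2⟩

/-- Approximate Poincaré–Bendixson theorem (quantitative form):
an (ε/L)-cycle is found within time O((L/ε)^d) along any orbit. -/
theorem approx_poincare_bendixson_quantitative (d : ℕ) (hd : 2 ≤ d) :
    ∃ C : ℝ, 0 < C ∧
      ∀ (ε L : ℝ), 0 < ε → ε < 1 → ε ≤ L →
      ∀ (f : EuclideanSpace ℝ (Fin d) → EuclideanSpace ℝ (Fin d)),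
        (∀ a b, ‖f a - f b‖ ≤ L * ‖a - b‖) →
      ∀ (x : ℝ → EuclideanSpace ℝ (Fin d)),
        (∀ t, 0 ≤ t → HasDerivAt x (f (x t)) t) →
        (∀ t, 0 ≤ t → ∀ i, x t i ∈ Set.Icc (0 : ℝ) 1) →
        (∀ y : EuclideanSpace ℝ (Fin d), (∀ i, y i ∈ Set.Icc (0 : ℝ) 1) → ε ≤ ‖f y‖) →
      ∃ t₁ t₂ : ℝ, 0 ≤ t₁ ∧ t₁ < t₂ ∧
        t₂ ≤ C * (1 + L / ε) ^ d / ε ∧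
        ‖x t₂ - x t₁‖ ≤ ε / L ∧
        ⟪x t₂ - x t₁, f (x t₁)⟫ = 0 ∧
        0 < ⟪f (x t₁), f (x t₂)⟫ := by
  have hd0 : (2 : ℝ) ≤ d := by exact_mod_cast hd
  refine ⟨2 * (16 * d) ^ d, by positivity, ?_⟩
  intro ε L hε _ hεL f hf x hx hcube hfε
  have hL : 0 < L := hε.trans_le hεL
  obtain ⟨N, hNdef⟩ : ∃ N, N = ⌈16 * d * (L / ε)⌉₊ := ⟨_, rfl⟩
  have hN : 0 < N := by rw [hNdef]; exact Nat.ceil_pos.2 (by positivity)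
  have hN0 : (0 : ℝ) < N := by exact_mod_cast hN
  have hNge : 16 * d * (L / ε) ≤ N := hNdef ▸ Nat.le_ceil _
  have hNle : (N : ℝ) + 1 ≤ 16 * d * (1 + L / ε) := by
    have := Nat.ceil_lt_add_one (show 0 ≤ 16 * d * (L / ε) by positivity)
    rw [← hNdef] at this
    linarith
  obtain ⟨j, k, hjk, hk, hclose⟩ := exists_lt_norm_sub_le_of_mem_cube hN (fun k => x (k / L))
    fun k i => hcube _ (by positivity) i
  have hsep : (j / L + 1 / L : ℝ) ≤ k / L := by
    rw [← add_div]
    gcongr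
    exact_mod_cast hjk
  have hsmall : (d / N : ℝ) ≤ ε / (16 * L) := by
    rw [div_le_div_iff₀ hN0 (by positivity)]
    calc (d : ℝ) * (16 * L) = ε * (16 * d * (L / ε)) := by field_simp
      _ ≤ ε * N := by gcongr
  have hj : (0 : ℝ) ≤ j / L := by positivity
  obtain ⟨s', h1, h2, h3⟩ := exists_return_of_norm_sub_le hε hL hf hx hj hsep
    (hfε _ (hcube _ hj)) (hclose.trans hsmall)
  refine ⟨j / L, s', hj, h1, h2.trans ?_, h3⟩
  have hk' : (k : ℝ) ≤ ((N : ℝ) + 1) ^ d := by exact_mod_cast hk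
  calc (k / L + 1 / L : ℝ) = (k + 1) / L := by ring
    _ ≤ (2 * ((N : ℝ) + 1) ^ d) / L := by
        gcongr
        linarith [one_le_pow₀ (show (1 : ℝ) ≤ (N : ℝ) + 1 by linarith) (n := d)]
    _ ≤ (2 * (16 * d * (1 + L / ε)) ^ d) / ε := by gcongr
    _ = 2 * (16 * d) ^ d * (1 + L / ε) ^ d / ε := by rw [mul_pow (16 * (d : ℝ))]; ring
end

section
/- Intersecting normal balls yield an approximate cycle: Let E be a real inner product space, let ε > 0 and L > 0, and let f : E → E be L-Lipschitz continuous. Suppose x₁, x₂, p ∈ E satisfy ‖f(x₁)‖ ≥ ε, ‖f(x₂)‖ ≥ ε, ‖p − x₁‖ ≤ ε/(3L), ⟨p − x₁, f(x₁)⟩ = 0, ‖p − x₂‖ ≤ ε/(3L), and ⟨p − x₂, f(x₂)⟩ = 0 (i.e. p lies in both normal balls B(x₁, ε/(3L)) and B(x₂, ε/(3L))). Then ‖x₁ − x₂‖ ≤ 2ε/(3L) and ⟨f(x₁), f(x₂)⟩ > 0. -/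
open RealInnerProductSpace

/-- Intersecting normal balls yield an approximate cycle. -/
theorem approx_cycle_of_intersecting_normal_balls
    {E : Type*} [NormedAddCommGroup E] [InnerProductSpace ℝ E]
    (ε L : ℝ) (hε : 0 < ε) (hL : 0 < L) (f : E → E)
    (hf : ∀ a b, ‖f a - f b‖ ≤ L * ‖a - b‖)
    (x₁ x₂ p : E)
    (hx₁ : ε ≤ ‖f x₁‖) (hx₂ : ε ≤ ‖f x₂‖)
    (hp₁ : ‖p - x₁‖ ≤ ε / (3 * L)) (hp₁' : ⟪p - x₁, f x₁⟫ = 0)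
    (hp₂ : ‖p - x₂‖ ≤ ε / (3 * L)) (hp₂' : ⟪p - x₂, f x₂⟫ = 0) :
    ‖x₁ - x₂‖ ≤ 2 * ε / (3 * L) ∧ 0 < ⟪f x₁, f x₂⟫ := by
  have hdist : ‖x₁ - x₂‖ ≤ 2 * ε / (3 * L) := by
    calc ‖x₁ - x₂‖ = ‖(p - x₂) - (p - x₁)‖ := by congr 1; abel
      _ ≤ ‖p - x₂‖ + ‖p - x₁‖ := norm_sub_le _ _
      _ ≤ ε / (3 * L) + ε / (3 * L) := add_le_add hp₂ hp₁
      _ = 2 * ε / (3 * L) := by ring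
  refine ⟨hdist, ?_⟩
  have hclose : ‖f x₁ - f x₂‖ ≤ 2 * ε / 3 := by
    calc ‖f x₁ - f x₂‖ ≤ L * ‖x₁ - x₂‖ := hf _ _
      _ ≤ L * (2 * ε / (3 * L)) := by gcongr
      _ = 2 * ε / 3 := by field_simp
  have hexpand := norm_sub_sq_real (f x₁) (f x₂)
  have hsq : ‖f x₁ - f x₂‖ ^ 2 ≤ (2 * ε / 3) ^ 2 := by gcongr
  have hsq₁ : ε ^ 2 ≤ ‖f x₁‖ ^ 2 := by gcongr
  have hsq₂ : ε ^ 2 ≤ ‖f x₂‖ ^ 2 := by gcongr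
  have hpos : 0 < ε ^ 2 := by positivity
  linarith
end

section
/- Convergence of the radial dynamics in the annulus construction: Let φ : ℝ → ℝ be continuous and strictly decreasing on [0,1], with φ(0) > 0 and φ(1) < 0, and let ζ ∈ (0,1) be its (unique) root, φ(ζ) = 0. Let r : [0,∞) → ℝ be differentiable with r(t) ∈ [1,2] and r'(t) = φ(r(t) − 1) for all t ≥ 0. Then r(t) → 1 + ζ as t → ∞. -/
theorem antitoneOn_Ici_of_hasDerivAt_nonpos {f f' : ℝ → ℝ} {a : ℝ}
    (hf : ∀ t, a ≤ t → HasDerivAt f (f' t) t) (hf' : ∀ t, a ≤ t → f' t ≤ 0) :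
    AntitoneOn f (Set.Ici a) := by
  refine antitoneOn_of_deriv_nonpos (convex_Ici a)
    (fun t ht => (hf t ht).continuousAt.continuousWithinAt) ?_ ?_
  · intro t ht
    exact (hf t (interior_subset ht)).differentiableAt.differentiableWithinAt
  · intro t ht
    rw [(hf t (interior_subset ht)).deriv]
    exact hf' t (interior_subset ht)

theorem StrictAntiOn.mul_sub_pos_of_root {φ : ℝ → ℝ} {s : Set ℝ} {ζ x : ℝ}
    (hφ : StrictAntiOn φ s) (hζ : ζ ∈ s) (hroot : φ ζ = 0) (hx : x ∈ s) (hne : x ≠ ζ) :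
    0 < (ζ - x) * φ x := by
  rcases lt_or_gt_of_ne hne with h | h
  · exact mul_pos (sub_pos.2 h) (hroot ▸ hφ hx hζ h)
  · exact mul_pos_of_neg_of_neg (sub_neg.2 h) (hroot ▸ hφ hζ hx h)

/-- Convergence of the radial dynamics in the annulus construction:
the radius tends to the unique limit-cycle radius `1 + ζ`. -/
theorem annulus_radial_convergence
    (φ : ℝ → ℝ)
    (hcont : ContinuousOn φ (Set.Icc 0 1))
    (hanti : StrictAntiOn φ (Set.Icc 0 1))
    (h0 : 0 < φ 0) (h1 : φ 1 < 0)
    (ζ : ℝ) (hζ : ζ ∈ Set.Ioo (0 : ℝ) 1) (hroot : φ ζ = 0)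
    (r : ℝ → ℝ)
    (hr : ∀ t, 0 ≤ t → HasDerivAt r (φ (r t - 1)) t)
    (hmem : ∀ t, 0 ≤ t → r t ∈ Set.Icc (1 : ℝ) 2) :
    Filter.Tendsto r Filter.atTop (nhds (1 + ζ)) := by
  have hζ' : ζ ∈ Set.Icc (0 : ℝ) 1 := Set.Ioo_subset_Icc_self hζ
  have hx : ∀ t, 0 ≤ t → r t - 1 ∈ Set.Icc (0 : ℝ) 1 := fun t ht =>
    ⟨by linarith [(hmem t ht).1], by linarith [(hmem t ht).2]⟩
  have hV : ∀ t, 0 ≤ t → HasDerivAt (fun t => (r t - (1 + ζ)) ^ 2)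
      (-2 * ((ζ - (r t - 1)) * φ (r t - 1))) t := fun t ht => by
    refine (((hr t ht).sub_const (1 + ζ)).pow 2).congr_deriv ?_
    push_cast
    ring
  have hanti_V : AntitoneOn (fun t => (r t - (1 + ζ)) ^ 2) (Set.Ici 0) := by
    refine antitoneOn_Ici_of_hasDerivAt_nonpos hV fun t ht => ?_
    by_cases hne : r t - 1 = ζ
    · simp [hne]
    · linarith [hanti.mul_sub_pos_of_root hζ' hroot (hx t ht) hne]
  rw [Metric.tendsto_atTop]
  intro ε hε
  obtain ⟨T, hT, hTε⟩ : ∃ T, 0 ≤ T ∧ |r T - (1 + ζ)| < ε := by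
    by_contra! hfar
    have hK : IsCompact (Set.Icc (0 : ℝ) 1 ∩ {x | ε ≤ |x - ζ|}) :=
      isCompact_Icc.inter_right (isClosed_le (by fun_prop) (by fun_prop))
    have hcontK : ContinuousOn (fun x => (ζ - x) * φ x)
        (Set.Icc (0 : ℝ) 1 ∩ {x | ε ≤ |x - ζ|}) :=
      (continuousOn_const.sub continuousOn_id).mul (hcont.mono Set.inter_subset_left)
    obtain ⟨c, hc, hcK⟩ := hK.exists_forall_le' hcontK (a := 0) fun x hxK =>
      hanti.mul_sub_pos_of_root hζ' hroot hxK.1 fun h => by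
        have := hxK.2
        simp only [Set.mem_ofPred_eq, h, sub_self, abs_zero] at this
        linarith
    have hdecay : AntitoneOn (fun t => (r t - (1 + ζ)) ^ 2 + c * t) (Set.Ici 0) := by
      refine antitoneOn_Ici_of_hasDerivAt_nonpos
        (fun t ht => (hV t ht).add ((hasDerivAt_id t).const_mul c)) fun t ht => ?_
      have hfar_t : ε ≤ |r t - 1 - ζ| := by
        simpa only [sub_sub] using hfar t ht
      linarith [hcK (r t - 1) ⟨hx t ht, hfar_t⟩]
    have ht : 0 ≤ ((r 0 - (1 + ζ)) ^ 2 + 1) / c := by positivity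
    have hle := hdecay (Set.mem_Ici.2 le_rfl) (Set.mem_Ici.2 ht) ht
    simp only [mul_zero, add_zero, mul_div_cancel₀ _ hc.ne'] at hle
    linarith [sq_nonneg (r (((r 0 - (1 + ζ)) ^ 2 + 1) / c) - (1 + ζ))]
  refine ⟨T, fun t ht => ?_⟩
  rw [Real.dist_eq]
  exact (sq_le_sq.1 (hanti_V hT (hT.trans ht) ht)).trans_lt hTε
end
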